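/- Every rotation of the circle (the map x ↦ x + α on ℝ/ℤ, for any α ∈ ℝ/ℤ) is a distortion element of Diff^∞(ℝ/ℤ): there exists a finite subset S ⊆ Diff^∞(ℝ/ℤ) such that the rotation R_α lies in the subgroup generated by S and d_S(R_α^n, id)/n → 0 as n → ∞. -/

import Mathlib

open Filter Topology Set

noncomputable section

/-- The circle ℝ/ℤ. -/
abbrev S1 := AddCircle (1 : ℝ)

/-- `F : ℝ → ℝ` is a lift of the circle map `f`: it is C^∞, commutes with the unit
translation, has everywhere positive derivative, and descends to `f` on ℝ/ℤ. -/
def IsLift (f : Equiv.Perm S1) (F : ℝ → ℝ) : Prop :=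
  ContDiff ℝ (⊤ : ℕ∞) F ∧ (∀ x, F (x + 1) = F x + 1) ∧ (∀ x, 0 < deriv F x) ∧
    ∀ x : ℝ, f (x : S1) = ((F x : ℝ) : S1)

/-- `f` is an orientation preserving C^∞ diffeomorphism of ℝ/ℤ. -/
def HasLift (f : Equiv.Perm S1) : Prop := ∃ F, IsLift f F

/-- max over 0 ≤ j ≤ k of sup over x of |F^(j)(x) - G^(j)(x)|. -/
noncomputable def liftDist (k : ℕ) (F G : ℝ → ℝ) : ℝ :=
  ⨆ j : Fin (k + 1), ⨆ x : ℝ, |iteratedDeriv (j : ℕ) F x - iteratedDeriv (j : ℕ) G x|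

/-- The C^k distance between two smooth circle diffeomorphisms: infimum over lifts. -/
noncomputable def distC (k : ℕ) (f g : Equiv.Perm S1) : ℝ :=
  sInf {d | ∃ F G, IsLift f F ∧ IsLift g G ∧ d = liftDist k F G}

/-- `f` is recurrent: for every k and ε > 0 there are arbitrarily large n ≥ 1 with
‖f^n − id‖_{C^k} < ε. -/
def Recurrent (f : Equiv.Perm S1) : Prop :=
  ∀ k : ℕ, ∀ ε : ℝ, 0 < ε → ∀ N : ℕ, ∃ n : ℕ, N ≤ n ∧ 1 ≤ n ∧ distC k (f ^ n) 1 < ε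

/-- The word length of `g` with respect to the generating set `S`: the least `k` such that
`g` is a product of `k` elements of `S ∪ S⁻¹`. -/
noncomputable def wordLength (S : Set (Equiv.Perm S1)) (g : Equiv.Perm S1) : ℕ :=
  sInf {k | ∃ l : List (Equiv.Perm S1),
    l.length = k ∧ (∀ x ∈ l, x ∈ S ∨ x⁻¹ ∈ S) ∧ l.prod = g}

/-- The rotation by `t` on ℝ/ℤ, `x ↦ x + t`. -/
def rot (t : S1) : Equiv.Perm S1 := Equiv.addRight t

/-- `f` is a distortion element of Diff^∞(ℝ/ℤ). -/
def IsDistortion (f : Equiv.Perm S1) : Prop :=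
  ∃ S : Finset (Equiv.Perm S1), (∀ g ∈ S, HasLift g) ∧
    f ∈ Subgroup.closure (S : Set (Equiv.Perm S1)) ∧
    Tendsto (fun n : ℕ => (wordLength (S : Set (Equiv.Perm S1)) (f ^ n) : ℝ) / n)
      atTop (nhds 0)

/-- The open arc in ℝ/ℤ which is the image of the interval `(a,b)`. -/
def arcOO (a b : ℝ) : Set S1 := (fun x : ℝ => (x : S1)) '' Set.Ioo a b

/-- The closed arc in ℝ/ℤ which is the image of the interval `[a,b]`. -/
def arcCC (a b : ℝ) : Set S1 := (fun x : ℝ => (x : S1)) '' Set.Icc a b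

/-- `f` is supported on `U`: it is the identity outside `U`. -/
def SupportedOn (f : Equiv.Perm S1) (U : Set S1) : Prop := ∀ x : S1, x ∉ U → f x = x

/-- `f` has rotation number `t ∈ ℝ/ℤ`. -/
def HasRotNum (f : Equiv.Perm S1) (t : S1) : Prop :=
  ∃ F : ℝ → ℝ, ∃ τ : ℝ, IsLift f F ∧ ((τ : ℝ) : S1) = t ∧
    Tendsto (fun n : ℕ => F^[n] 0 / n) atTop (nhds τ)

/-- A real number is Diophantine. -/
def DiophantineReal (t : ℝ) : Prop :=
  ∃ C : ℝ, 0 < C ∧ ∃ n : ℕ, 0 < n ∧ ∀ p q : ℤ, q ≠ 0 →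
    C / |(q : ℝ)| ^ n < |(q : ℝ) * t - (p : ℝ)|

/-- An element of ℝ/ℤ is Diophantine if some (equivalently, every) lift is. -/
def Diophantine (t : S1) : Prop := ∃ τ : ℝ, (τ : S1) = t ∧ DiophantineReal τ



/-! ### Lifts -/

def DL : Subgroup (Equiv.Perm ℝ) where
  carrier := {f | ∀ x, f (x + 1) = f x + 1}
  mul_mem' := by
    intro a b ha hb x
    simp only [Set.mem_ofPred_eq] at ha hb
    simp [Equiv.Perm.mul_apply, ha, hb]
  one_mem' := by intro x; simp
  inv_mem' := by
    intro a ha x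
    simp only [Set.mem_ofPred_eq] at ha
    apply a.injective
    rw [ha]; simp

theorem DL_per (f : DL) (x : ℝ) : f.1 (x + 1) = f.1 x + 1 := f.2 x

def projFun (f : DL) : S1 → S1 :=
  Function.Periodic.lift (f := fun x : ℝ => ((f.1 x : ℝ) : S1)) (c := (1:ℝ)) (by
    intro x
    show ((f.1 (x+1) : ℝ) : S1) = _
    rw [DL_per]
    exact AddCircle.coe_add_period (1:ℝ) _)

theorem projFun_coe (f : DL) (x : ℝ) : projFun f (x : S1) = ((f.1 x : ℝ) : S1) := rfl

def proj : DL →* Equiv.Perm S1 where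
  toFun f :=
    { toFun := projFun f
      invFun := projFun f⁻¹
      left_inv := by
        intro x
        induction x using QuotientAddGroup.induction_on with
        | H x => 
          show projFun f⁻¹ (projFun f (x : S1)) = (x : S1)
          rw [projFun_coe, projFun_coe]; simp
      right_inv := by
        intro x
        induction x using QuotientAddGroup.induction_on with
        | H x => 
          show projFun f (projFun f⁻¹ (x : S1)) = (x : S1)
          rw [projFun_coe, projFun_coe]; simp }
  map_one' := by
    ext x
    induction x using QuotientAddGroup.induction_on with
    | H x => rfl
  map_mul' := by
    intro f g
    ext x
    induction x using QuotientAddGroup.induction_on with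
    | H x => rfl

theorem proj_coe (f : DL) (x : ℝ) : proj f (x : S1) = ((f.1 x : ℝ) : S1) := rfl

theorem hasLift_proj (f : DL) (h : ContDiff ℝ (⊤ : ℕ∞) f.1) (h' : ∀ x, 0 < deriv f.1 x) :
    HasLift (proj f) := ⟨f.1, h, f.2, h', fun _ => rfl⟩

/-! ### Words -/

/-- The commutator. -/
def cm {G : Type*} [Group G] (g h : G) : G := g * h * g⁻¹ * h⁻¹

def WL {G : Type*} [Group G] (S : Set G) (g : G) (k : ℕ) : Prop :=
  ∃ l : List G, l.length ≤ k ∧ (∀ x ∈ l, x ∈ S ∨ x⁻¹ ∈ S) ∧ l.prod = g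

section words
variable {G : Type*} [Group G] {S S' : Set G} {g h : G} {k k' : ℕ}

theorem WL.mono (H : WL S g k) (hS : S ⊆ S') (hk : k ≤ k') : WL S' g k' := by
  obtain ⟨l, h1, h2, h3⟩ := H
  exact ⟨l, h1.trans hk, fun x hx => (h2 x hx).imp (fun h => hS h) (fun h => hS h), h3⟩

theorem WL.of_mem (H : g ∈ S) : WL S g 1 := ⟨[g], by simp, by simp [H], by simp⟩

theorem WL.one : WL S (1 : G) 0 := ⟨[], by simp, by simp, by simp⟩

theorem WL.mul (H : WL S g k) (H' : WL S h k') : WL S (g * h) (k + k') := by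
  obtain ⟨l, h1, h2, h3⟩ := H
  obtain ⟨l', h1', h2', h3'⟩ := H'
  refine ⟨l ++ l', by simp; omega, ?_, by simp [h3, h3']⟩
  intro x hx
  rcases List.mem_append.1 hx with hx | hx
  · exact h2 x hx
  · exact h2' x hx

theorem WL.inv (H : WL S g k) : WL S g⁻¹ k := by
  obtain ⟨l, h1, h2, h3⟩ := H
  refine ⟨(l.map fun x => x⁻¹).reverse, by simpa using h1, ?_, by
    rw [← h3, List.prod_inv_reverse]⟩
  intro x hx
  simp only [List.mem_reverse, List.mem_map] at hx
  obtain ⟨y, hy, rfl⟩ := hx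
  rcases h2 y hy with h | h
  · right; simpa using h
  · left; exact h

theorem WL.pow (H : WL S g k) (n : ℕ) : WL S (g ^ n) (n * k) := by
  induction n with
  | zero => simpa using WL.one
  | succ n ih => rw [pow_succ, Nat.succ_mul]; exact ih.mul H

theorem WL.comm (H : WL S g k) (H' : WL S h k') : WL S (cm g h) (k + k' + k + k') := by
  unfold cm
  exact ((H.mul H').mul H.inv).mul H'.inv

end words

def Short (w : ℝ → Equiv.Perm S1) : Prop :=
  ∃ K : ℕ → ℕ, ∃ τ : ℕ → ℝ, (∀ n, 0 < τ n) ∧ ∀ s : ℕ → ℝ, (∀ n, |s n| < τ n) →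
    ∃ S : Finset (Equiv.Perm S1), (∀ g ∈ S, HasLift g) ∧
      ∀ n, WL (S : Set (Equiv.Perm S1)) (w (s n)) (K n)

theorem Short.mul {w w' : ℝ → Equiv.Perm S1} (h : Short w) (h' : Short w') :
    Short (fun s => w s * w' s) := by
  classical
  obtain ⟨K, τ, hτ, H⟩ := h
  obtain ⟨K', τ', hτ', H'⟩ := h'
  refine ⟨fun n => K n + K' n, fun n => min (τ n) (τ' n), fun n => lt_min (hτ n) (hτ' n), ?_⟩
  intro s hs
  obtain ⟨S, hS, h1⟩ := H s fun n => (lt_min_iff.1 (hs n)).1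
  obtain ⟨S', hS', h1'⟩ := H' s fun n => (lt_min_iff.1 (hs n)).2
  refine ⟨S ∪ S', ?_, ?_⟩
  · intro g hg
    rcases Finset.mem_union.1 hg with hg | hg
    · exact hS g hg
    · exact hS' g hg
  · intro n
    exact ((h1 n).mono (by simp) le_rfl).mul ((h1' n).mono (by simp) le_rfl)

theorem Short.conj {w : ℝ → Equiv.Perm S1} (h : Short w) (g : Equiv.Perm S1) (hg : HasLift g) :
    Short (fun s => g * w s * g⁻¹) := by
  classical
  obtain ⟨K, τ, hτ, H⟩ := h
  refine ⟨fun n => 1 + K n + 1, τ, hτ, ?_⟩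
  intro s hs
  obtain ⟨S, hS, h1⟩ := H s hs
  refine ⟨insert g S, ?_, ?_⟩
  · intro g' hg'
    rcases Finset.mem_insert.1 hg' with h | h
    · rw [h]; exact hg
    · exact hS _ h
  · intro n
    have hw : WL ((insert g S : Finset _) : Set (Equiv.Perm S1)) g 1 := WL.of_mem (by simp)
    exact (hw.mul ((h1 n).mono (by simp) le_rfl)).mul hw.inv

/-! ### Smooth families -/

def SF : Subgroup (ℝ → DL) where
  carrier := {f | ContDiff ℝ (⊤ : ℕ∞) (fun p : ℝ × ℝ => (f p.1).1 p.2) ∧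
    ContDiff ℝ (⊤ : ℕ∞) (fun p : ℝ × ℝ => (f p.1).1.symm p.2)}
  mul_mem' := by
    rintro a b ⟨ha, ha'⟩ ⟨hb, hb'⟩
    exact ⟨ha.comp (contDiff_fst.prodMk hb), hb'.comp (contDiff_fst.prodMk ha')⟩
  one_mem' := ⟨contDiff_snd, contDiff_snd⟩
  inv_mem' := by
    rintro a ⟨ha, ha'⟩
    exact ⟨ha', ha⟩

theorem strictMono_bij {F : ℝ → ℝ} (hF : Continuous F) (hm : StrictMono F)
    (hp : ∀ x, F (x + 1) = F x + 1) : Function.Bijective F := by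
  refine ⟨hm.injective, ?_⟩
  have hn : ∀ n : ℕ, F n = F 0 + n := by
    intro n
    induction n with
    | zero => simp
    | succ n ih => push_cast; rw [hp, ih]; ring
  have hn' : ∀ n : ℕ, F (-n) = F 0 - n := by
    intro n
    induction n with
    | zero => simp
    | succ n ih =>
      have := hp (-(n+1 : ℝ))
      push_cast
      rw [show -(n+1 : ℝ) + 1 = -n by ring, ih] at this
      linarith
  intro y
  obtain ⟨n, hn1⟩ := exists_nat_ge (|y - F 0|)
  have h1 : y ∈ Icc (F (-n)) (F n) := by
    rw [hn, hn']
    have := abs_le.1 hn1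
    constructor <;> linarith
  have := intermediate_value_Icc (show (-n : ℝ) ≤ n by
    have : (0:ℝ) ≤ n := Nat.cast_nonneg n
    linarith) hF.continuousOn h1
  obtain ⟨x, _, hx⟩ := this
  exact ⟨x, hx⟩

theorem mkFam (F : ℝ × ℝ → ℝ) (hF : ContDiff ℝ (⊤ : ℕ∞) F)
    (hp : ∀ s x, F (s, x + 1) = F (s, x) + 1) (hd : ∀ s x, 0 < deriv (fun y => F (s, y)) x) :
    ∃ f ∈ SF, ∀ s x, (f s).1 x = F (s, x) := by
  have hsl : ∀ s, ContDiff ℝ (⊤ : ℕ∞) (fun y => F (s, y)) := fun s =>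
    hF.comp (contDiff_const.prodMk contDiff_id)
  have hm : ∀ s, StrictMono (fun y => F (s, y)) := fun s => strictMono_of_deriv_pos (hd s)
  have hb : ∀ s, Function.Bijective (fun y => F (s, y)) := fun s =>
    strictMono_bij (hsl s).continuous (hm s) (hp s)
  let f : ℝ → DL := fun s => ⟨Equiv.ofBijective _ (hb s), hp s⟩
  have hf : ∀ s x, (f s).1 x = F (s, x) := fun s x => rfl
  refine ⟨f, ⟨hF, ?_⟩, hf⟩
  let g : ℝ × ℝ → ℝ × ℝ := fun p => (p.1, F p)
  have hg : ContDiff ℝ (⊤ : ℕ∞) g := contDiff_fst.prodMk hF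
  have hginj : Function.Injective g := by
    rintro ⟨a, b⟩ ⟨c, d⟩ h
    simp only [g, Prod.mk.injEq] at h
    obtain ⟨rfl, h⟩ := h
    rw [(hb a).1 h]
  let k : ℝ × ℝ → ℝ × ℝ := fun p => (p.1, (f p.1).1.symm p.2)
  have hgk : ∀ p, g (k p) = p := by
    rintro ⟨a, b⟩
    simp only [g, k, Prod.mk.injEq, true_and]
    exact (f a).1.apply_symm_apply b
  suffices h : ContDiff ℝ (⊤ : ℕ∞) k from contDiff_snd.comp h
  rw [contDiff_iff_contDiffAt]
  intro y
  obtain ⟨a, rfl⟩ : ∃ a, g a = y := ⟨k y, hgk y⟩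
  have hda : deriv (fun y => F (a.1, y)) a.2 = fderiv ℝ F a (0, 1) := by
    have h1 : HasFDerivAt F (fderiv ℝ F a) (a.1, a.2) :=
      (hF.differentiable (by simp) a).hasFDerivAt
    have h2 : HasDerivAt (fun y : ℝ => (a.1, y)) ((0:ℝ), (1:ℝ)) a.2 :=
      (hasDerivAt_const _ _).prodMk (hasDerivAt_id _)
    exact (h1.comp_hasDerivAt a.2 h2).deriv
  have hne : fderiv ℝ F a (0, 1) ≠ 0 := by rw [← hda]; exact (hd _ _).ne'
  let e : (ℝ × ℝ) ≃L[ℝ] (ℝ × ℝ) := (ContinuousLinearEquiv.refl ℝ ℝ).skewProd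
    (ContinuousLinearEquiv.unitsEquivAut ℝ (Units.mk0 _ hne))
    ((fderiv ℝ F a).comp (ContinuousLinearMap.inl ℝ ℝ ℝ))
  have he : HasFDerivAt g (e : (ℝ × ℝ) →L[ℝ] (ℝ × ℝ)) a := by
    have h1 : HasFDerivAt g ((ContinuousLinearMap.fst ℝ ℝ ℝ).prod (fderiv ℝ F a)) a :=
      hasFDerivAt_fst.prodMk (hF.differentiable (by simp) a).hasFDerivAt
    convert! h1 using 1
    ext <;> simp [e]
    exact (fderiv ℝ F a).map_zero
  have hn : ((⊤ : ℕ∞) : WithTop ℕ∞) ≠ 0 := by simp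
  have h1 := hg.contDiffAt.to_localInverse he hn
  refine h1.congr_of_eventuallyEq ?_
  have h2 := (hg.contDiffAt.hasStrictFDerivAt' he hn).eventually_right_inverse
  filter_upwards [h2] with z hz
  apply hginj
  rw [hgk]
  exact hz.symm

/-! ### Smallness -/

structure Nice (φ : ℝ × ℝ → ℝ) : Prop where
  smooth : ContDiff ℝ (⊤ : ℕ∞) φ
  zero : ∀ x, φ (0, x) = 0
  per : ∀ s x, φ (s, x + 1) = φ (s, x)

theorem Nice.deriv_eq {φ : ℝ × ℝ → ℝ} (h : Nice φ) (s x : ℝ) :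
    HasDerivAt (fun y => φ (s, y)) (fderiv ℝ φ (s, x) (0, 1)) x := by
  have h1 : HasFDerivAt φ (fderiv ℝ φ (s, x)) (s, x) :=
    (h.smooth.differentiable (by simp) _).hasFDerivAt
  have h2 : HasDerivAt (fun y : ℝ => (s, y)) ((0:ℝ), (1:ℝ)) x :=
    (hasDerivAt_const _ _).prodMk (hasDerivAt_id _)
  exact h1.comp_hasDerivAt x h2

theorem Nice.deriv {φ : ℝ × ℝ → ℝ} (h : Nice φ) :
    Nice (fun p => deriv (fun y => φ (p.1, y)) p.2) := by
  refine ⟨?_, ?_, ?_⟩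
  · have : (fun p : ℝ × ℝ => _root_.deriv (fun y => φ (p.1, y)) p.2) =
        fun p => fderiv ℝ φ p (0, 1) := by
      ext p
      exact (h.deriv_eq p.1 p.2).deriv
    rw [this]
    exact (h.smooth.fderiv_right (m := (⊤ : ℕ∞)) (by simp)).clm_apply contDiff_const
  · intro x
    simp [h.zero]
  · intro s x
    have : (fun y => φ (s, y)) = fun y => φ (s, y + 1) := by ext y; rw [h.per]
    simp only
    conv_rhs => rw [this]
    rw [deriv_comp_add_const (fun y => φ (s, y)) 1 x]

theorem Nice.small0 {φ : ℝ × ℝ → ℝ} (h : Nice φ) {η : ℝ} (hη : 0 < η) :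
    ∃ τ > 0, ∀ s, |s| < τ → ∀ x, |φ (s, x)| ≤ η := by
  have h1 : ∀ᶠ s in 𝓝 (0:ℝ), ∀ x ∈ Icc (0:ℝ) 1, |φ (s, x)| < η := by
    apply isCompact_Icc.eventually_forall_of_forall_eventually (P := fun s x => |φ (s, x)| < η)
    intro y _
    have : ContinuousAt (fun z : ℝ × ℝ => |φ (z.1, z.2)|) (0, y) :=
      h.smooth.continuous.abs.continuousAt
    apply this.eventually_lt continuousAt_const
    simpa [h.zero] using hη
  obtain ⟨τ, hτ, H⟩ := Metric.eventually_nhds_iff.1 h1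
  refine ⟨τ, hτ, fun s hs x => ?_⟩
  have hp : Function.Periodic (fun x => φ (s, x)) 1 := fun x => h.per s x
  have h2 : φ (s, Int.fract x) = φ (s, x) := by
    have := hp.sub_int_mul_eq (x := x) ⌊x⌋
    rw [mul_one] at this
    exact this
  rw [← h2]
  exact (H (by simpa using hs) _ ⟨Int.fract_nonneg x, (Int.fract_lt_one x).le⟩).le

theorem Nice.small {φ : ℝ × ℝ → ℝ} (h : Nice φ) {η : ℝ} (hη : 0 < η) (N : ℕ) :
    ∃ τ > 0, ∀ s, |s| < τ → ∀ k ≤ N, ∀ x, |iteratedDeriv k (fun y => φ (s, y)) x| ≤ η := by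
  have key : ∀ k, ∀ φ : ℝ × ℝ → ℝ, Nice φ → 
      ∃ τ > 0, ∀ s, |s| < τ → ∀ x, |iteratedDeriv k (fun y => φ (s, y)) x| ≤ η := by
    intro k
    induction k with
    | zero => 
      intro φ h
      simpa using h.small0 hη
    | succ k ih =>
      intro φ h
      obtain ⟨τ, hτ, H⟩ := ih _ h.deriv
      refine ⟨τ, hτ, fun s hs x => ?_⟩
      rw [iteratedDeriv_succ']
      exact H s hs x
  induction N with
  | zero =>
    obtain ⟨τ, hτ, H⟩ := key 0 φ h
    refine ⟨τ, hτ, fun s hs k hk => ?_⟩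
    obtain rfl : k = 0 := by omega
    exact H s hs
  | succ N ih =>
    obtain ⟨τ, hτ, H⟩ := key (N+1) φ h
    obtain ⟨τ', hτ', H'⟩ := ih
    refine ⟨min τ τ', lt_min hτ hτ', fun s hs k hk => ?_⟩
    rcases Nat.lt_or_ge N k with h | h
    · obtain rfl : k = N + 1 := by omega
      exact H s (lt_min_iff.1 hs).1
    · exact H' s (lt_min_iff.1 hs).2 k h


theorem bigU (C : DL) (hC : (fun _ => C) ∈ SF) (T : Set ℝ)
    (hdis : ∀ x, ∀ i j : ℕ, (C ^ i)⁻¹.1 x ∈ T → (C ^ j)⁻¹.1 x ∈ T → i = j)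
    (u : ℝ → DL) (hu : u ∈ SF) (hu0 : u 0 = 1) (huT : ∀ s x, x ∉ T → (u s).1 x = x)
    (a : ℕ → ℕ) (ha : Function.Injective a) :
    ∃ τ : ℕ → ℝ, (∀ n, 0 < τ n) ∧ ∀ s : ℕ → ℝ, (∀ n, |s n| < τ n) →
      ∃ U : DL, HasLift (proj U) ∧
        (∀ m x, (C ^ a m)⁻¹.1 x ∈ T → U.1 x = (C ^ a m * u (s m) * (C ^ a m)⁻¹).1 x) ∧
        (∀ x, (∀ m, (C ^ a m)⁻¹.1 x ∉ T) → U.1 x = x) := by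
  let W : ℕ → ℝ → DL := fun m => (fun _ => C) ^ a m * u * ((fun _ => C) ^ a m)⁻¹
  have hW : ∀ m, W m ∈ SF := fun m =>
    SF.mul_mem (SF.mul_mem (SF.pow_mem hC _) hu) (SF.inv_mem (SF.pow_mem hC _))
  have hWe : ∀ m s, W m s = C ^ a m * u s * (C ^ a m)⁻¹ := fun m s => rfl
  have hWT : ∀ m s x, (C ^ a m)⁻¹.1 x ∉ T → (W m s).1 x = x := by
    intro m s x hx
    rw [hWe]
    show (C ^ a m).1 ((u s).1 ((C ^ a m)⁻¹.1 x)) = x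
    rw [huT _ _ hx]
    exact (C ^ a m).1.apply_symm_apply x
  let ψ : ℕ → ℝ × ℝ → ℝ := fun m p => (W m p.1).1 p.2 - p.2
  have hψ : ∀ m, Nice (ψ m) := by
    intro m
    refine ⟨(hW m).1.sub contDiff_snd, ?_, ?_⟩
    · intro x
      simp [ψ, hWe, hu0]
    · intro s x
      simp only [ψ, DL_per]; ring
  choose τ hτ H using fun m : ℕ => (hψ m).small (η := (1/4:ℝ)^(m+1)) (by positivity) (m+1)
  refine ⟨τ, hτ, ?_⟩
  intro s hs
  let f : ℕ → ℝ → ℝ := fun m x => ψ m (s m, x)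
  have hfs : ∀ m, ContDiff ℝ (⊤ : ℕ∞) (f m) := fun m =>
    (hψ m).smooth.comp (contDiff_const.prodMk contDiff_id)
  have hfb : ∀ m, ∀ k ≤ m + 1, ∀ x, |iteratedDeriv k (f m) x| ≤ (1/4:ℝ)^(m+1) :=
    fun m k hk x => H m (s m) (hs m) k hk x
  have hsum : Summable fun m : ℕ => (1/4:ℝ)^(m+1) :=
    (summable_nat_add_iff 1).2 (summable_geometric_of_lt_one (by norm_num) (by norm_num))
  have hsumv : ∑' m : ℕ, (1/4:ℝ)^(m+1) = 1/3 := by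
    simp_rw [pow_succ]
    rw [tsum_mul_right, tsum_geometric_of_lt_one (by norm_num) (by norm_num)]
    norm_num
  have hg : ContDiff ℝ (⊤ : ℕ∞) fun x => ∑' m, f m x := by
    apply contDiff_tsum_of_eventually hfs (v := fun _ m => (1/4:ℝ)^(m+1)) (fun _ _ => hsum)
    intro k _
    rw [Nat.cofinite_eq_atTop]
    filter_upwards [eventually_ge_atTop k] with m hm x
    rw [norm_iteratedFDeriv_eq_norm_iteratedDeriv]
    exact hfb m k (by omega) x
  have hfd : ∀ m x, ‖deriv (f m) x‖ ≤ (1/4:ℝ)^(m+1) := by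
    intro m x
    have := hfb m 1 (by omega) x
    rwa [iteratedDeriv_one] at this
  have hf0 : ∀ x, Summable fun m => f m x := by
    intro x
    apply Summable.of_norm_bounded hsum
    intro m
    simpa using hfb m 0 (by omega) x
  have hgd : ∀ x, |deriv (fun x => ∑' m, f m x) x| ≤ 1/3 := by
    intro x
    rw [deriv_tsum_apply hsum (fun m => (hfs m).differentiable (by simp)) hfd (hf0 0), ← hsumv]
    exact tsum_of_norm_bounded hsum.hasSum fun m => hfd m x
  have hder : ∀ x, deriv (fun y => y + ∑' m, f m y) x = 1 + deriv (fun x => ∑' m, f m x) x := by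
    intro x
    have h1 := (hg.differentiable (by simp) x).hasDerivAt
    exact ((hasDerivAt_id x).add h1).deriv
  have hpos : ∀ x, 0 < deriv (fun y => y + ∑' m, f m y) x := by
    intro x
    rw [hder]
    have := abs_le.1 (hgd x)
    linarith
  obtain ⟨F, hF, hFe⟩ := mkFam (fun p => p.2 + ∑' m, f m p.2)
    (contDiff_snd.add (hg.comp contDiff_snd)) (by
      intro s' x
      have : ∀ m, f m (x + 1) = f m x := fun m => (hψ m).per _ _
      simp only [this]; ring) (fun _ x => hpos x)
  have hUe : ∀ x, (F 0).1 x = x + ∑' m, f m x := fun x => hFe 0 x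
  refine ⟨F 0, ?_, ?_, ?_⟩
  · have : ((F 0).1 : ℝ → ℝ) = fun x => x + ∑' m, f m x := funext hUe
    apply hasLift_proj
    · rw [this]; exact contDiff_id.add hg
    · rw [this]; exact hpos
  · intro m x hx
    rw [hUe, tsum_eq_single m, ← hWe]
    · simp [f, ψ]
    · intro m' hm'
      have : (C ^ a m')⁻¹.1 x ∉ T := fun h => hm' (ha (hdis x _ _ h hx))
      simp [f, ψ, hWT m' (s m') x this]
  · intro x hx
    rw [hUe]
    have : ∀ m, f m x = 0 := by
      intro m
      simp [f, ψ, hWT m (s m) x (hx m)]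
    simp [this]

theorem cm_isolate {α : Type*} (u v U V : Equiv.Perm α) (T : Set α)
    (hu : ∀ x, x ∉ T → u x = x) (hv : ∀ x, x ∉ T → v x = x)
    (hU : ∀ x ∈ T, U x = u x) (hV : ∀ x ∈ T, V x = v x)
    (hUV : ∀ x, x ∉ T → U x = x ∨ V x = x) : cm U V = cm u v := by
  obtain ⟨u', rfl⟩ : ∃ u', U = u * u' := ⟨u⁻¹ * U, by group⟩
  obtain ⟨v', rfl⟩ : ∃ v', V = v * v' := ⟨v⁻¹ * V, by group⟩
  have hu' : ∀ x ∈ T, u' x = x := fun x hx => u.injective (hU x hx)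
  have hv' : ∀ x ∈ T, v' x = x := fun x hx => v.injective (hV x hx)
  have huT : ∀ x, x ∉ T → (u * u') x = x → u' x = x := by
    intro x hx h
    apply u.injective
    rw [hu x hx]; exact h
  have hvT : ∀ x, x ∉ T → (v * v') x = x → v' x = x := by
    intro x hx h
    apply v.injective
    rw [hv x hx]; exact h
  have c1 : Commute u u' := Equiv.Perm.Disjoint.commute fun x => by
    by_cases h : x ∈ T
    · exact Or.inr (hu' x h)
    · exact Or.inl (hu x h)
  have c2 : Commute v v' := Equiv.Perm.Disjoint.commute fun x => by
    by_cases h : x ∈ T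
    · exact Or.inr (hv' x h)
    · exact Or.inl (hv x h)
  have c3 : Commute u v' := Equiv.Perm.Disjoint.commute fun x => by
    by_cases h : x ∈ T
    · exact Or.inr (hv' x h)
    · exact Or.inl (hu x h)
  have c4 : Commute v u' := Equiv.Perm.Disjoint.commute fun x => by
    by_cases h : x ∈ T
    · exact Or.inr (hu' x h)
    · exact Or.inl (hv x h)
  have c5 : Commute u' v' := Equiv.Perm.Disjoint.commute fun x => by
    by_cases h : x ∈ T
    · exact Or.inl (hu' x h)
    · exact (hUV x h).imp (huT x h) (hvT x h)
  unfold cm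
  have h1 : u * u' * (v * v') = (u * v) * (u' * v') := by
    rw [mul_assoc, mul_assoc, ← mul_assoc u' v, ← c4.eq, mul_assoc]
  have h2 : v * v' * (u * u') = (v * u) * (u' * v') := by
    rw [mul_assoc, mul_assoc, ← mul_assoc v' u, ← c3.eq, mul_assoc, c5.eq]
  calc u * u' * (v * v') * (u * u')⁻¹ * (v * v')⁻¹
      = (u * u' * (v * v')) * (v * v' * (u * u'))⁻¹ := by group
    _ = _ := by rw [h1, h2]; group

theorem pow3 {m n l : ℕ} (h : (3:ℤ) ^ m - 3 ^ n = 2 * 3 ^ l - 2 * 3 ^ n) : m = n ∧ l = n := by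
  have h' : (3:ℕ) ^ m + 3 ^ n = 2 * 3 ^ l := by zify; linarith
  have key : ∀ m k l : ℕ, (3:ℕ) ^ m + 3 ^ (m + k) = 2 * 3 ^ l → k = 0 ∧ l = m := by
    intro m k l h
    rw [pow_add] at h
    have h3 : 3 ^ m * (1 + 3 ^ k) = 2 * 3 ^ l := by rw [← h]; ring
    have hml : l = m := by
      by_contra hne
      rcases Nat.lt_or_gt_of_ne hne with hlt | hlt
      · obtain ⟨d, rfl⟩ := Nat.exists_eq_add_of_lt hlt
        have : 3 ^ (d+1) * (1 + 3 ^ k) = 2 := by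
          have h0 : 0 < 3 ^ l := by positivity
          apply Nat.eq_of_mul_eq_mul_left h0
          rw [← mul_assoc, ← pow_add, ← add_assoc, h3]; ring
        have h5 : 3 ^ (d+1) ≥ 3 := by
          rw [pow_succ]; have : 0 < 3 ^ d := by positivity
          omega
        have h6 : 0 < 3 ^ k := by positivity
        nlinarith
      · obtain ⟨d, rfl⟩ := Nat.exists_eq_add_of_lt hlt
        have : (1 + 3 ^ k) = 2 * 3 ^ (d+1) := by
          have h0 : 0 < 3 ^ m := by positivity
          apply Nat.eq_of_mul_eq_mul_left h0
          rw [h3, show m + d + 1 = m + (d+1) by ring, pow_add]; ring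
        rcases k with _ | k
        · rw [pow_succ] at this
          have : 0 < 3 ^ d := by positivity
          omega
        · rw [pow_succ, pow_succ] at this
          omega
    refine ⟨?_, hml⟩
    subst hml
    have h0 : 0 < 3 ^ l := by positivity
    have : 1 + 3 ^ k = 2 := by
      apply Nat.eq_of_mul_eq_mul_left h0
      rw [h3]; ring
    have : 3 ^ k = 3 ^ 0 := by omega
    exact Nat.pow_right_injective (le_refl 2 |>.trans (by norm_num)) this
  rcases le_total m n with hmn | hmn
  · obtain ⟨k, rfl⟩ := Nat.exists_eq_add_of_le hmn
    obtain ⟨h1, h2⟩ := key m k l h'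
    omega
  · obtain ⟨k, rfl⟩ := Nat.exists_eq_add_of_le hmn
    obtain ⟨h1, h2⟩ := key n k l (by rw [← h']; ring)
    omega

theorem short_local (C : DL) (hC : (fun _ => C) ∈ SF) (hCl : HasLift (proj C)) (T : Set ℝ)
    (hdis : ∀ x, ∀ i j : ℤ, (C ^ i)⁻¹.1 x ∈ T → (C ^ j)⁻¹.1 x ∈ T → i = j)
    (u v : ℝ → DL) (hu : u ∈ SF) (hu0 : u 0 = 1) (huT : ∀ s x, x ∉ T → (u s).1 x = x)
    (hv : v ∈ SF) (hv0 : v 0 = 1) (hvT : ∀ s x, x ∉ T → (v s).1 x = x) :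
    Short (fun s => proj (cm (u s) (v s))) := by
  classical
  have hdisN : ∀ x, ∀ i j : ℕ, (C ^ i)⁻¹.1 x ∈ T → (C ^ j)⁻¹.1 x ∈ T → i = j := by
    intro x i j h1 h2
    exact_mod_cast hdis x i j (by simpa using h1) (by simpa using h2)
  have h3 : Function.Injective (fun n : ℕ => 3 ^ n) := Nat.pow_right_injective (by norm_num)
  obtain ⟨τ, hτ, HU⟩ := bigU C hC T hdisN u hu hu0 huT (fun n => 3 ^ n) h3
  obtain ⟨τ', hτ', HV⟩ := bigU C hC T hdisN v hv hv0 hvT (fun n => 2 * 3 ^ n)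
    (fun a b h => h3 (by simpa using h))
  refine ⟨fun n => (3 ^ n * 1 + 1 + 3 ^ n * 1) + (2 * 3 ^ n * 1 + 1 + 2 * 3 ^ n * 1) +
     (3 ^ n * 1 + 1 + 3 ^ n * 1) + (2 * 3 ^ n * 1 + 1 + 2 * 3 ^ n * 1),
     fun n => min (τ n) (τ' n), fun n => lt_min (hτ n) (hτ' n), ?_⟩
  intro s hs
  obtain ⟨U, hUl, hU1, hU2⟩ := HU s fun n => (lt_min_iff.1 (hs n)).1
  obtain ⟨V, hVl, hV1, hV2⟩ := HV s fun n => (lt_min_iff.1 (hs n)).2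
  refine ⟨{proj U, proj V, proj C}, ?_, ?_⟩
  · intro g hg
    simp only [Finset.mem_insert, Finset.mem_singleton] at hg
    rcases hg with rfl | rfl | rfl <;> assumption
  · intro n
    set S : Set (Equiv.Perm S1) := (({proj U, proj V, proj C} : Finset (Equiv.Perm S1)) : Set (Equiv.Perm S1)) with hS
    have wU : WL S (proj U) 1 := WL.of_mem (by simp [hS])
    have wV : WL S (proj V) 1 := WL.of_mem (by simp [hS])
    have wC : WL S (proj C) 1 := WL.of_mem (by simp [hS])
    have main : cm (u (s n)) (v (s n)) =
        cm ((C ^ (3 ^ n))⁻¹ * U * C ^ (3 ^ n)) ((C ^ (2 * 3 ^ n))⁻¹ * V * C ^ (2 * 3 ^ n)) := by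
      apply Subtype.ext
      symm
      have hz : ∀ (a b : ℕ) (x : ℝ), (C ^ b)⁻¹.1 ((C ^ a).1 x) = (C ^ ((b:ℤ) - a))⁻¹.1 x := by
        intro a b x
        show ((C ^ b)⁻¹ * C ^ a).1 x = _
        congr 2
        rw [zpow_sub]
        simp only [zpow_natCast, mul_inv_rev, inv_inv]
        exact ((Commute.refl C).pow_pow b a).inv_left.eq
      have hz0 : ∀ x : ℝ, (C ^ (0:ℤ))⁻¹.1 x = x := by intro x; simp
      have supp : ∀ (a : ℕ → ℕ) (U : DL), (∀ x, (∀ m, (C ^ a m)⁻¹.1 x ∉ T) → U.1 x = x) →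
          ∀ x, ((C ^ a n)⁻¹ * U * C ^ a n).1 x ≠ x →
          ∃ m, (C ^ ((a m : ℤ) - a n))⁻¹.1 x ∈ T := by
        intro a U hU x hx
        by_contra! hcon
        apply hx
        show (C ^ a n)⁻¹.1 (U.1 ((C ^ a n).1 x)) = x
        rw [hU]
        · exact (C ^ a n).1.symm_apply_apply x
        · intro m
          rw [hz]; exact hcon m
      have on : ∀ (a : ℕ → ℕ) (U : DL) (w : DL), 
          (∀ x, (C ^ a n)⁻¹.1 x ∈ T → U.1 x = (C ^ a n * w * (C ^ a n)⁻¹).1 x) →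
          ∀ x ∈ T, ((C ^ a n)⁻¹ * U * C ^ a n).1 x = w.1 x := by
        intro a U w hU x hx
        have h1 : (C ^ a n)⁻¹.1 ((C ^ a n).1 x) = x := (C ^ a n).1.symm_apply_apply x
        show (C ^ a n)⁻¹.1 (U.1 ((C ^ a n).1 x)) = w.1 x
        rw [hU _ (by rw [h1]; exact hx)]
        show (C ^ a n)⁻¹.1 ((C ^ a n).1 (w.1 ((C ^ a n)⁻¹.1 ((C ^ a n).1 x)))) = w.1 x
        rw [h1]
        exact (C ^ a n).1.symm_apply_apply _
      refine cm_isolate (u (s n)).1 (v (s n)).1 ((C ^ (3 ^ n))⁻¹ * U * C ^ (3 ^ n)).1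
        ((C ^ (2 * 3 ^ n))⁻¹ * V * C ^ (2 * 3 ^ n)).1 T (huT _) (hvT _) ?_ ?_ ?_
      · exact on (fun n => 3 ^ n) U (u (s n)) (hU1 n)
      · exact on (fun n => 2 * 3 ^ n) V (v (s n)) (hV1 n)
      · intro x hx
        by_contra! hcon
        obtain ⟨m, hm⟩ := supp (fun n => 3 ^ n) U hU2 x hcon.1
        obtain ⟨l, hl⟩ := supp (fun n => 2 * 3 ^ n) V hV2 x hcon.2
        have h := hdis x _ _ hm hl
        push_cast at h
        obtain ⟨rfl, rfl⟩ := pow3 h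
        apply hx
        simpa using hm
    simp only [main]
    have hcm : ∀ a b : DL, proj (cm a b) = cm (proj a) (proj b) := by
      intro a b; simp [cm]
    rw [hcm]
    simp only [map_mul, map_inv, map_pow]
    exact (((wC.pow _).inv.mul wU).mul (wC.pow _)).comm (((wC.pow _).inv.mul wV).mul (wC.pow _))

theorem HasLift.mul {f g : Equiv.Perm S1} (hf : HasLift f) (hg : HasLift g) :
    HasLift (f * g) := by
  obtain ⟨F, h1, h2, h3, h4⟩ := hf
  obtain ⟨G, k1, k2, k3, k4⟩ := hg
  refine ⟨F ∘ G, h1.comp k1, ?_, ?_, ?_⟩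
  · intro x; simp [k2, h2]
  · intro x
    rw [deriv_comp x (h1.differentiable (by simp) _) (k1.differentiable (by simp) _)]
    exact mul_pos (h3 _) (k3 _)
  · intro x
    simp [Equiv.Perm.mul_apply, k4, h4]

theorem HasLift.one : HasLift (1 : Equiv.Perm S1) :=
  ⟨id, contDiff_id, by simp, by simp, by simp⟩

theorem HasLift.pow {f : Equiv.Perm S1} (hf : HasLift f) (n : ℕ) : HasLift (f ^ n) := by
  induction n with
  | zero => simpa using HasLift.one
  | succ n ih => rw [pow_succ]; exact ih.mul hf

def TT : Set ℝ := {x | (1/100 : ℝ) ≤ Int.fract x ∧ Int.fract x ≤ 99/100}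

theorem exists_C : ∃ C : DL, (fun _ => C) ∈ SF ∧ HasLift (proj C) ∧
    ∀ x, ∀ i j : ℤ, (C ^ i)⁻¹.1 x ∈ TT → (C ^ j)⁻¹.1 x ∈ TT → i = j := by
  let d : ℝ → ℝ := fun x => (1 - Real.cos (2 * Real.pi * x)) / 10
  have hd0 : ∀ x, 0 ≤ d x := fun x => by
    have := Real.cos_le_one (2 * Real.pi * x)
    simp only [d]; linarith
  have hdz : ∀ (x : ℝ) (n : ℤ), d (x - n) = d x := by
    intro x n
    simp only [d]
    rw [mul_sub, mul_comm (2 * Real.pi) (n:ℝ), Real.cos_sub_int_mul_two_pi]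
  have hds : ContDiff ℝ (⊤ : ℕ∞) d := by
    simp only [d]
    fun_prop
  have hder : ∀ x, HasDerivAt (fun x => x + d x)
      (1 + (2 * Real.pi * Real.sin (2 * Real.pi * x)) / 10) x := by
    intro x
    have h1 : HasDerivAt (fun x : ℝ => 2 * Real.pi * x) (2 * Real.pi) x := by
      simpa using (hasDerivAt_id x).const_mul (2 * Real.pi)
    have h2 := ((h1.cos.const_sub 1).div_const 10)
    have := (hasDerivAt_id x).add h2
    convert! this using 1
    ring
  have hpos : ∀ x, 0 < deriv (fun x => x + d x) x := by
    intro x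
    rw [(hder x).deriv]
    have h1 := Real.neg_one_le_sin (2 * Real.pi * x)
    have h2 := Real.pi_lt_four
    have h3 := Real.pi_pos
    nlinarith
  obtain ⟨F, hF, hFe⟩ := mkFam (fun p => p.2 + d p.2) (contDiff_snd.add (hds.comp contDiff_snd))
    (by
      intro s x
      have := hdz (x + 1) 1
      simp at this
      simp only [← this]; ring) (fun _ x => hpos x)
  let A := F 0
  have hA : ∀ x, A.1 x = x + d x := fun x => hFe 0 x
  have hAS : (fun _ => A) ∈ SF := by
    refine ⟨?_, ?_⟩
    · exact hF.1.comp ((contDiff_const (c := (0:ℝ))).prodMk contDiff_snd)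
    · exact hF.2.comp ((contDiff_const (c := (0:ℝ))).prodMk contDiff_snd)
  have hAl : HasLift (proj A) := by
    have : (A.1 : ℝ → ℝ) = fun x => x + d x := funext hA
    apply hasLift_proj
    · rw [this]; exact contDiff_id.add hds
    · rw [this]; exact hpos
  have hmono : StrictMono (fun x => x + d x) := strictMono_of_deriv_pos hpos
  have hfr : ∀ x, Int.fract (A.1 x) = Int.fract x + d (Int.fract x) := by
    intro x
    rw [Int.fract_eq_iff]
    refine ⟨add_nonneg (Int.fract_nonneg x) (hd0 _), ?_, ⌊x⌋, ?_⟩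
    · have := hmono (Int.fract_lt_one x)
      simp only at this
      have h1 : d 1 = 0 := by simp [d]
      rw [h1] at this
      linarith
    · rw [hA, Int.fract, hdz]; ring
  obtain ⟨m, hm, hmd⟩ : ∃ m > 0, ∀ y ∈ Icc (1/100:ℝ) (99/100), m ≤ d y := by
    obtain ⟨z, hz, hz'⟩ := (isCompact_Icc (a := (1/100:ℝ)) (b := 99/100)).exists_isMinOn
      ⟨1/100, by norm_num⟩ hds.continuous.continuousOn
    refine ⟨d z, ?_, fun y hy => hz' hy⟩
    have h1 : Real.cos (2 * Real.pi * z) = 1 - 2 * Real.sin (Real.pi * z) ^ 2 := by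
      rw [mul_assoc, Real.cos_two_mul, Real.cos_sq']; ring
    have h2 : 0 < Real.sin (Real.pi * z) := by
      apply Real.sin_pos_of_pos_of_lt_pi
      · exact mul_pos Real.pi_pos (by linarith [hz.1])
      · nlinarith [hz.2, Real.pi_pos]
    simp only [d, h1]
    have := pow_pos h2 2
    linarith
  have hit : ∀ (j : ℕ) x, 1/100 ≤ Int.fract x → 1/100 ≤ Int.fract ((A ^ j).1 x) ∧
      (99/100 < Int.fract ((A ^ j).1 x) ∨ j * m ≤ Int.fract ((A ^ j).1 x)) := by
    intro j x hx
    induction j with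
    | zero => 
      refine ⟨by simpa using hx, Or.inr ?_⟩
      simp
    | succ j ih =>
      have : (A ^ (j+1)).1 x = A.1 ((A ^ j).1 x) := by rw [pow_succ']; rfl
      rw [this, hfr]
      have h0 := hd0 (Int.fract ((A ^ j).1 x))
      refine ⟨by linarith [ih.1], ?_⟩
      by_cases hc : 99/100 < Int.fract ((A ^ j).1 x)
      · left; linarith
      · right
        have h1 := ih.2.resolve_left hc
        have h2 := hmd _ ⟨ih.1, not_lt.1 hc⟩
        rw [Nat.cast_succ, add_mul, one_mul]
        linarith
  obtain ⟨L, hL⟩ := exists_nat_gt (1 / m)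
  have hL1 : 1 < L * m := by rwa [div_lt_iff₀ hm] at hL
  have hwan : ∀ (k : ℕ) x, x ∈ TT → ((A ^ L) ^ (k+1)).1 x ∉ TT := by
    intro k x hx hx'
    rw [← pow_mul] at hx'
    obtain ⟨h1, h2⟩ := hit (L * (k+1)) x hx.1
    rcases h2 with h2 | h2
    · exact absurd hx'.2 (not_le.2 h2)
    · have := Int.fract_lt_one ((A ^ (L * (k+1))).1 x)
      have e : ((L * (k+1) : ℕ) : ℝ) = L * (k+1) := by push_cast; ring
      rw [e] at h2
      have hk : (0:ℝ) ≤ k := Nat.cast_nonneg k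
      nlinarith
  refine ⟨A ^ L, SF.pow_mem hAS L, by rw [map_pow]; exact hAl.pow L, ?_⟩
  have key : ∀ x, ∀ i j : ℤ, ((A ^ L) ^ i)⁻¹.1 x ∈ TT → ((A ^ L) ^ j)⁻¹.1 x ∈ TT → ¬ i < j := by
    intro x i j hi hj hij
    obtain ⟨k, rfl⟩ := Int.le.dest (show i + 1 ≤ j from hij)
    apply hwan k _ hj
    have : ((A ^ L) ^ (k+1)).1 (((A ^ L) ^ (i + 1 + (k:ℤ)))⁻¹.1 x) = ((A ^ L) ^ i)⁻¹.1 x := by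
      show ((A ^ L) ^ (k+1) * ((A ^ L) ^ (i + 1 + (k:ℤ)))⁻¹).1 x = _
      congr 2
      rw [← zpow_natCast, ← zpow_neg, ← zpow_add, ← zpow_neg]
      congr 1
      push_cast; ring
    rw [this]; exact hi
  intro x i j hi hj
  rcases lt_trichotomy i j with h | h | h
  · exact absurd h (key x i j hi hj)
  · exact h
  · exact absurd h (key x j i hj hi)

/-- local commutators are short -/
theorem short_zero (u v : ℝ → DL) (hu : u ∈ SF) (hu0 : u 0 = 1) (hv : v ∈ SF) (hv0 : v 0 = 1)
    (huT : ∀ s x, 9/10 ≤ Real.cos (2 * Real.pi * x) → (u s).1 x = x) 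
    (hvT : ∀ s x, 9/10 ≤ Real.cos (2 * Real.pi * x) → (v s).1 x = x) :
    Short (fun s => proj (cm (u s) (v s))) := by
  obtain ⟨C, h1, h2, h3⟩ := exists_C
  have key : ∀ x, x ∉ TT → 9/10 ≤ Real.cos (2 * Real.pi * x) := by
    intro x hx
    have hpi := Real.pi_lt_four
    have hpi0 := Real.pi_pos
    have hb : ∀ y : ℝ, |y| ≤ 1/100 → 9/10 ≤ Real.cos (2 * Real.pi * y) := by
      intro y hy
      have := Real.one_sub_sq_div_two_le_cos (x := 2 * Real.pi * y)
      have hy2 : y ^ 2 ≤ (1/100) ^ 2 := by rw [← sq_abs]; gcongr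
      have hp2 : Real.pi ^ 2 ≤ 16 := by nlinarith
      have : (2 * Real.pi * y) ^ 2 / 2 = 2 * (Real.pi ^ 2 * y ^ 2) := by ring
      have : Real.pi ^ 2 * y ^ 2 ≤ 16 * (1/100) ^ 2 := by gcongr
      linarith
    have hc : ∀ n : ℤ, Real.cos (2 * Real.pi * (x - n)) = Real.cos (2 * Real.pi * x) := by
      intro n
      rw [mul_sub, mul_comm (2 * Real.pi) (n:ℝ), Real.cos_sub_int_mul_two_pi]
    have hf0 := Int.fract_nonneg x
    have hf1 := Int.fract_lt_one x
    by_cases h : 1/100 ≤ Int.fract x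
    · have h' : 99/100 < Int.fract x := by
        by_contra h''
        exact hx ⟨h, not_lt.1 h''⟩
      rw [← hc (⌊x⌋ + 1)]
      apply hb
      have : x - ((⌊x⌋ + 1 : ℤ) : ℝ) = Int.fract x - 1 := by
        push_cast; rw [Int.fract]; ring
      rw [this, abs_le]; constructor <;> linarith
    · rw [← hc ⌊x⌋]
      apply hb
      change |Int.fract x| ≤ _
      rw [abs_le]; constructor <;> linarith
  exact short_local C h1 h2 TT h3 u v hu hu0 (fun s x hx => huT s x (key x hx)) hv hv0
    (fun s x hx => hvT s x (key x hx))

theorem famOf {θ : ℝ × ℝ → ℝ} (h : Nice θ) : ∃ δ₀ > 0, ∀ δ, 0 < δ → δ < δ₀ →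
    ∃ f ∈ SF, f 0 = 1 ∧ (∀ s x, (f s).1 x = x + θ (δ * Real.sin s, x)) ∧
      ∀ s x, |(f s).1 x - x| ≤ 1/100 := by
  obtain ⟨τ, hτ, H⟩ := h.small (η := 1/100) (by norm_num) 1
  refine ⟨τ, hτ, fun δ hδ hδ' => ?_⟩
  have hb : ∀ s, |δ * Real.sin s| < τ := by
    intro s
    rw [abs_mul, abs_of_pos hδ]
    have := Real.abs_sin_le_one s
    nlinarith
  have hsl : ∀ s, ContDiff ℝ (⊤ : ℕ∞) (fun y => θ (s, y)) := fun s =>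
    h.smooth.comp (contDiff_const.prodMk contDiff_id)
  obtain ⟨f, hf, hfe⟩ := mkFam (fun p => p.2 + θ (δ * Real.sin p.1, p.2)) (by
      apply contDiff_snd.add
      apply h.smooth.comp
      apply ContDiff.prodMk _ contDiff_snd
      exact contDiff_const.mul (Real.contDiff_sin.comp contDiff_fst)) (by
      intro s x
      simp only [h.per]; ring) (by
      intro s x
      have h1 := ((hsl (δ * Real.sin s)).differentiable (by simp) x).hasDerivAt
      have h2 := ((hasDerivAt_id x).add h1).deriv
      have h3 := H _ (hb s) 1 le_rfl x
      rw [iteratedDeriv_one] at h3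
      have h4 := abs_le.1 h3
      change 0 < deriv (id + fun y => θ (δ * Real.sin s, y)) x
      rw [h2]
      linarith)
  refine ⟨f, hf, ?_, hfe, ?_⟩
  · apply Subtype.ext
    ext x
    rw [hfe]
    simp [h.zero]
  · intro s x
    rw [hfe]
    simpa using H _ (hb s) 0 (by norm_num) x

theorem Nice.bump {φ : ℝ × ℝ → ℝ} (h : Nice φ) (c d : ℝ) :
    Nice (fun p => Real.smoothTransition (c + d * Real.cos (2 * Real.pi * p.2)) * φ p) := by
  refine ⟨?_, ?_, ?_⟩
  · refine ContDiff.mul ?_ h.smooth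
    apply Real.smoothTransition.contDiff.comp
    fun_prop
  · intro x; simp [h.zero]
  · intro s x
    simp only [h.per, mul_add, mul_one, Real.cos_add_two_pi]

theorem cm_agree (f f' g : DL) (h : ∀ x, g.1 x ≠ x → f.1 x = f'.1 x) : cm f g = cm f' g := by
  have hc : Commute (f'⁻¹ * f) g := by
    have : Commute (f'⁻¹ * f).1 g.1 := Equiv.Perm.Disjoint.commute fun x => by
      by_cases hx : g.1 x = x
      · exact Or.inr hx
      · left
        show f'.1.symm (f.1 x) = x
        rw [h x hx]; simp
    exact Subtype.ext this.eq
  unfold cm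
  have : f * g * f⁻¹ = f' * g * f'⁻¹ := by
    have h1 : f'⁻¹ * f * g = g * (f'⁻¹ * f) := hc.eq
    calc f * g * f⁻¹ = f' * (f'⁻¹ * f * g) * f⁻¹ := by group
      _ = _ := by rw [h1]; group
  rw [this]

def half : DL := ⟨Equiv.addRight (1/2 : ℝ), fun x => by simp; ring⟩

theorem half_apply (x : ℝ) : half.1 x = x + 1/2 := rfl
theorem half_inv_apply (x : ℝ) : (half⁻¹).1 x = x - 1/2 := by
  show half.1.symm x = _
  rw [Equiv.symm_apply_eq, half_apply]; ring

theorem hasLift_half : HasLift (proj half) := by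
  have : (half.1 : ℝ → ℝ) = fun x => x + 1/2 := funext half_apply
  apply hasLift_proj
  · rw [this]; fun_prop
  · intro x
    rw [this]; simp

theorem half_SF : (fun _ => half) ∈ SF := by
  refine ⟨?_, ?_⟩
  · simp only [half_apply]; fun_prop
  · have : ∀ x, half.1.symm x = x - 1/2 := half_inv_apply
    simp only [this]; fun_prop

theorem cm_conj {G : Type*} [Group G] (g a b : G) :
    cm (g * a * g⁻¹) (g * b * g⁻¹) = g * cm a b * g⁻¹ := by
  unfold cm; group

theorem cm_conj' {G : Type*} [Group G] (g a b : G) :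
    g * cm (g⁻¹ * a * g) (g⁻¹ * b * g) * g⁻¹ = cm a b := by
  unfold cm; group

theorem short_half (u v : ℝ → DL) (hu : u ∈ SF) (hu0 : u 0 = 1) (hv : v ∈ SF) (hv0 : v 0 = 1)
    (huT : ∀ s x, Real.cos (2 * Real.pi * x) ≤ -(9/10) → (u s).1 x = x) 
    (hvT : ∀ s x, Real.cos (2 * Real.pi * x) ≤ -(9/10) → (v s).1 x = x) :
    Short (fun s => proj (cm (u s) (v s))) := by
  have hcos : ∀ x, Real.cos (2 * Real.pi * (x + 1/2)) = - Real.cos (2 * Real.pi * x) := by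
    intro x
    rw [← Real.cos_add_pi]; congr 1; ring
  have key : ∀ w : ℝ → DL, (∀ s x, Real.cos (2 * Real.pi * x) ≤ -(9/10) → (w s).1 x = x) →
      ∀ s x, 9/10 ≤ Real.cos (2 * Real.pi * x) → (half⁻¹ * w s * half).1 x = x := by
    intro w hw s x hx
    show (half⁻¹).1 ((w s).1 (half.1 x)) = x
    rw [half_apply, hw, half_inv_apply]
    · ring
    · rw [hcos]; linarith
  have hS : ∀ w ∈ SF, (fun s => half⁻¹ * w s * half) ∈ SF := fun w hw =>
    SF.mul_mem (SF.mul_mem (SF.inv_mem half_SF) hw) half_SF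
  have := (short_zero (fun s => half⁻¹ * u s * half) (fun s => half⁻¹ * v s * half)
    (hS u hu) (by simp [hu0]) (hS v hv) (by simp [hv0]) (key u huT) (key v hvT)).conj
    (proj half) hasLift_half
  simp only [← map_mul, ← map_inv, cm_conj'] at this
  exact this

theorem frag {φ ψ : ℝ × ℝ → ℝ} (hφ : Nice φ) (hψ : Nice ψ) : ∃ δ₀ > 0, ∀ δ, 0 < δ → δ < δ₀ →
    ∃ a b : ℝ → DL, (∀ s x, (a s).1 x = x + φ (δ * Real.sin s, x)) ∧
      (∀ s x, (b s).1 x = x + ψ (δ * Real.sin s, x)) ∧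
      Short (fun s => proj (cm (a s) (b s))) := by
  obtain ⟨d1, hd1, H1⟩ := famOf hφ
  obtain ⟨d2, hd2, H2⟩ := famOf hψ
  obtain ⟨d3, hd3, H3⟩ := famOf (hψ.bump (1/2) 1)
  obtain ⟨d4, hd4, H4⟩ := famOf (hφ.bump 3 4)
  obtain ⟨d5, hd5, H5⟩ := famOf (hφ.bump 3 (-4))
  refine ⟨min d1 (min d2 (min d3 (min d4 d5))), by positivity, fun δ hδ hδ' => ?_⟩
  simp only [lt_min_iff] at hδ'
  obtain ⟨e1, e2, e3, e4, e5⟩ := hδ'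
  obtain ⟨a, ha, ha0, hae, -⟩ := H1 δ hδ e1
  obtain ⟨b, hb, hb0, hbe, -⟩ := H2 δ hδ e2
  obtain ⟨b₁, hb₁, hb₁0, hb₁e, hb₁s⟩ := H3 δ hδ e3
  obtain ⟨a₁, ha₁, ha₁0, ha₁e, -⟩ := H4 δ hδ e4
  obtain ⟨a₂, ha₂, ha₂0, ha₂e, -⟩ := H5 δ hδ e5
  refine ⟨a, b, hae, hbe, ?_⟩
  have b₁id : ∀ s x, Real.cos (2 * Real.pi * x) ≤ -(1/2) → (b₁ s).1 x = x := by
    intro s x hx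
    rw [hb₁e, Real.smoothTransition.zero_of_nonpos (by simp only; linarith)]; ring
  have b₁eq : ∀ s x, 1/2 ≤ Real.cos (2 * Real.pi * x) → (b₁ s).1 x = (b s).1 x := by
    intro s x hx
    rw [hb₁e, Real.smoothTransition.one_of_one_le (by simp only; linarith), hbe]; ring
  have a₁id : ∀ s x, Real.cos (2 * Real.pi * x) ≤ -(3/4) → (a₁ s).1 x = x := by
    intro s x hx
    rw [ha₁e, Real.smoothTransition.zero_of_nonpos (by simp only; linarith)]; ring
  have a₁eq : ∀ s x, -(1/2) ≤ Real.cos (2 * Real.pi * x) → (a s).1 x = (a₁ s).1 x := by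
    intro s x hx
    rw [ha₁e, Real.smoothTransition.one_of_one_le (by simp only; linarith), hae]; ring
  have a₂id : ∀ s x, 3/4 ≤ Real.cos (2 * Real.pi * x) → (a₂ s).1 x = x := by
    intro s x hx
    rw [ha₂e, Real.smoothTransition.zero_of_nonpos (by simp only; linarith)]; ring
  have a₂eq : ∀ s x, Real.cos (2 * Real.pi * x) ≤ 1/2 → (a s).1 x = (a₂ s).1 x := by
    intro s x hx
    rw [ha₂e, Real.smoothTransition.one_of_one_le (by simp only; linarith), hae]; ring
  let b₂ : ℝ → DL := b₁⁻¹ * b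
  have hb₂ : b₂ ∈ SF := SF.mul_mem (SF.inv_mem hb₁) hb
  have b₂e : ∀ s, b₂ s = (b₁ s)⁻¹ * b s := fun s => rfl
  have b₂id : ∀ s x, 1/2 ≤ Real.cos (2 * Real.pi * x) → (b₂ s).1 x = x := by
    intro s x hx
    show (b₁ s).1.symm ((b s).1 x) = x
    rw [← b₁eq s x hx]; simp
  have key : ∀ s, cm (a s) (b s) = cm (a₁ s) (b₁ s) *
      cm (b₁ s * a₂ s * (b₁ s)⁻¹) (b₁ s * b₂ s * (b₁ s)⁻¹) := by
    intro s
    rw [cm_conj, ← cm_agree (a s) (a₁ s) (b₁ s), ← cm_agree (a s) (a₂ s) (b₂ s), b₂e]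
    · unfold cm; group
    · intro x hx
      apply a₂eq
      by_contra h
      exact hx (b₂id s x (not_le.1 h).le)
    · intro x hx
      apply a₁eq
      by_contra h
      exact hx (b₁id s x (not_le.1 h).le)
  simp only [key, map_mul]
  have conjid : ∀ w : ℝ → DL, (∀ s x, 3/4 ≤ Real.cos (2 * Real.pi * x) → (w s).1 x = x) →
      ∀ s x, 9/10 ≤ Real.cos (2 * Real.pi * x) → (b₁ s * w s * (b₁ s)⁻¹).1 x = x := by
    intro w hw s x hx
    show (b₁ s).1 ((w s).1 ((b₁ s).1.symm x)) = x
    set y := (b₁ s).1.symm x with hy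
    have hyx : (b₁ s).1 y = x := by simp [hy]
    have h1 := hb₁s s y
    rw [hyx] at h1
    rw [hw, hyx]
    have h2 := Real.abs_cos_sub_cos_le (2 * Real.pi * x) (2 * Real.pi * y)
    rw [← mul_sub, abs_mul, abs_of_pos (by positivity : 0 < 2 * Real.pi)] at h2
    have h3 := abs_le.1 h2
    have h4 : 2 * Real.pi * |x - y| ≤ 2 * Real.pi * (1/100) := by gcongr
    have h5 := Real.pi_lt_four
    linarith [h3.2]
  refine Short.mul ?_ ?_
  · exact short_half a₁ b₁ ha₁ ha₁0 hb₁ hb₁0 (fun s x hx => a₁id s x (by linarith))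
      (fun s x hx => b₁id s x (by linarith))
  · exact short_zero (fun s => b₁ s * a₂ s * (b₁ s)⁻¹) (fun s => b₁ s * b₂ s * (b₁ s)⁻¹)
      (SF.mul_mem (SF.mul_mem hb₁ ha₂) (SF.inv_mem hb₁)) (by simp [ha₂0])
      (SF.mul_mem (SF.mul_mem hb₁ hb₂) (SF.inv_mem hb₁)) (by simp [b₂e, hb₁0, hb0])
      (conjid a₂ a₂id) (conjid b₂ (fun s x hx => b₂id s x (by linarith)))

/-- Complex coordinate on the circle. -/
def EE (x : S1) : ℂ := (AddCircle.toCircle x : ℂ)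

theorem EE_coe (x : ℝ) : EE (x : S1) = Complex.exp ((2 * Real.pi * x : ℝ) * Complex.I) := by
  unfold EE
  rw [AddCircle.toCircle_apply_mk, Circle.coe_exp]
  simp

theorem EE_add (x y : S1) : EE (x + y) = EE x * EE y := by
  unfold EE; rw [AddCircle.toCircle_add]; simp

theorem EE_inj {x y : S1} (h : EE x = EE y) : x = y :=
  AddCircle.injective_toCircle one_ne_zero (Subtype.ext h)

/-- `f` is given by a fractional linear map. -/
def Mob (f : Equiv.Perm S1) (a b c d : ℂ) : Prop :=
  ∀ x, EE (f x) * (c * EE x + d) = a * EE x + b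

theorem Mob.mul {f g : Equiv.Perm S1} {a b c d a' b' c' d' : ℂ} (hf : Mob f a b c d)
    (hg : Mob g a' b' c' d') :
    Mob (f * g) (a * a' + b * c') (a * b' + b * d') (c * a' + d * c') (c * b' + d * d') := by
  intro x
  have h1 := hf (g x)
  have h2 := hg x
  show EE (f (g x)) * _ = _
  linear_combination (c' * EE x + d') * h1 + (a - EE (f (g x)) * c) * h2

theorem Mob.inv {f : Equiv.Perm S1} {a b c d : ℂ} (hf : Mob f a b c d) :
    Mob f⁻¹ d (-b) (-c) a := by
  intro x
  have h1 := hf (f⁻¹ x)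
  rw [show f (f⁻¹ x) = x from f.apply_symm_apply x] at h1
  linear_combination -h1

theorem Mob.scale {f : Equiv.Perm S1} {a b c d a' b' c' d' : ℂ} (hf : Mob f a' b' c' d') (k : ℂ)
    (hk : k ≠ 0) (ha : a' = k * a) (hb : b' = k * b) (hc : c' = k * c) (hd : d' = k * d) :
    Mob f a b c d := by
  intro x
  have h1 := hf x
  subst ha hb hc hd
  apply mul_left_cancel₀ hk
  linear_combination h1

theorem Mob.rot {f : Equiv.Perm S1} {a d : ℂ} (hf : Mob f a 0 0 d) (hd : d ≠ 0) (e : S1)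
    (he : EE e * d = a) : f = rot e := by
  ext x
  apply EE_inj
  show _ = EE (x + e)
  rw [EE_add]
  apply mul_right_cancel₀ hd
  have := hf x
  linear_combination this - EE x * he

theorem arctan_exp (y : ℝ) : Complex.exp ((2 * Real.arctan y : ℝ) * Complex.I) *
    (1 - y * Complex.I) = 1 + y * Complex.I := by
  have hp : 0 < 1 + y^2 := by positivity
  have hs : Real.sqrt (1 + y^2) ^ 2 = 1 + y^2 := Real.sq_sqrt hp.le
  have h0 : Real.sqrt (1+y^2) ≠ 0 := (Real.sqrt_pos.2 hp).ne'
  have h1 : Complex.exp ((2 * Real.arctan y : ℝ) * Complex.I) =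
      (Complex.exp ((Real.arctan y : ℝ) * Complex.I))^2 := by
    rw [← Complex.exp_nat_mul]; congr 1; push_cast; ring
  have h2 : Complex.exp ((Real.arctan y : ℝ) * Complex.I) * (Real.sqrt (1 + y^2) : ℂ) =
      1 + y * Complex.I := by
    rw [Complex.exp_mul_I, ← Complex.ofReal_cos, ← Complex.ofReal_sin, Real.cos_arctan,
      Real.sin_arctan]
    have : (Real.sqrt (1+y^2) : ℂ) ≠ 0 := by exact_mod_cast h0
    push_cast
    field_simp
  have hsC : (Real.sqrt (1 + y^2) : ℂ) ^ 2 = 1 + (y:ℂ)^2 := by exact_mod_cast hs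
  have hz : (1 + (y:ℂ)^2) ≠ 0 := by exact_mod_cast hp.ne'
  rw [h1]
  apply mul_left_cancel₀ hz
  have I2 := Complex.I_sq
  set e := Complex.exp ((Real.arctan y : ℝ) * Complex.I)
  set r := (Real.sqrt (1 + y^2) : ℂ)
  have h3 : e^2 * (1 + (y:ℂ)^2) = (1 + y * Complex.I)^2 := by rw [← hsC, ← h2]; ring
  linear_combination (1 - y * Complex.I) * h3 - (y^2 * (1 + y * Complex.I)) * I2

theorem arctan_exp' (u v : ℝ) (hu : 0 < u) :
    Complex.exp ((2 * Real.arctan (v / u) : ℝ) * Complex.I) *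
    (u - v * Complex.I) = u + v * Complex.I := by
  have := arctan_exp (v / u)
  have hu' : (u : ℂ) ≠ 0 := by exact_mod_cast hu.ne'
  have hv : ((v / u : ℝ) : ℂ) * u = v := by push_cast; field_simp
  linear_combination u * this + (Complex.exp ((2 * Real.arctan (v / u) : ℝ) * Complex.I) * Complex.I +
    Complex.I) * hv

theorem EE_lift (x u v : ℝ) (hu : 0 < u) :
    EE ((x + Real.arctan (v / u) / Real.pi : ℝ) : S1) * (u - v * Complex.I) =
      EE (x : S1) * (u + v * Complex.I) := by
  have : ((x + Real.arctan (v / u) / Real.pi : ℝ) : S1) =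
    (x : S1) + ((Real.arctan (v / u) / Real.pi : ℝ) : S1) := by push_cast; rfl
  rw [this, EE_add, EE_coe (Real.arctan (v / u) / Real.pi)]
  have h2 : 2 * Real.pi * (Real.arctan (v / u) / Real.pi) = 2 * Real.arctan (v / u) := by
    field_simp
  rw [h2, mul_assoc, arctan_exp' u v hu]

theorem EE_cs (x : ℝ) : EE (x : S1) =
    Real.cos (2 * Real.pi * x) + Real.sin (2 * Real.pi * x) * Complex.I := by
  rw [EE_coe, Complex.exp_mul_I, Complex.ofReal_cos, Complex.ofReal_sin]

theorem mob_H (f : DL) (t : ℝ) (ht : |t| < 1)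
    (hf : ∀ x, f.1 x = x + Real.arctan ((- t * Real.sin (2 * Real.pi * x)) /
      (1 + t * Real.cos (2 * Real.pi * x))) / Real.pi) : Mob (proj f) 1 t t 1 := by
  intro x
  induction x using QuotientAddGroup.induction_on with
  | H x =>
    show EE ((f.1 x : ℝ) : S1) * (t * EE (x : S1) + 1) = 1 * EE (x : S1) + t
    have hu : 0 < 1 + t * Real.cos (2 * Real.pi * x) := by
      have h1 := Real.abs_cos_le_one (2 * Real.pi * x)
      have h2 : |t * Real.cos (2 * Real.pi * x)| < 1 := by
        rw [abs_mul]; nlinarith [abs_nonneg t, abs_nonneg (Real.cos (2 * Real.pi * x))]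
      linarith [(abs_lt.1 h2).1]
    have h := EE_lift x _ (- t * Real.sin (2 * Real.pi * x)) hu
    rw [← hf] at h
    have sc : (Real.cos (2 * Real.pi * x) : ℂ)^2 + (Real.sin (2 * Real.pi * x) : ℂ)^2 = 1 := by
      exact_mod_cast Real.cos_sq_add_sin_sq _
    rw [EE_cs x] at h ⊢
    have I2 := Complex.I_sq
    push_cast at h
    push_cast at sc ⊢
    linear_combination h - t * Complex.sin (2 * Real.pi * x)^2 * I2 + t * sc

theorem mob_P (f : DL) (t : ℝ) (ht : |t| < 1)
    (hf : ∀ x, f.1 x = x + Real.arctan ((t * (1 - Real.cos (2 * Real.pi * x))) /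
      (1 - t * Real.sin (2 * Real.pi * x))) / Real.pi) :
    Mob (proj f) (1 + t * Complex.I) (-t * Complex.I) (t * Complex.I) (1 - t * Complex.I) := by
  intro x
  induction x using QuotientAddGroup.induction_on with
  | H x =>
    show EE ((f.1 x : ℝ) : S1) * (t * Complex.I * EE (x : S1) + (1 - t * Complex.I)) =
      (1 + t * Complex.I) * EE (x : S1) + -t * Complex.I
    have hu : 0 < 1 - t * Real.sin (2 * Real.pi * x) := by
      have h1 := Real.abs_sin_le_one (2 * Real.pi * x)
      have h2 : |t * Real.sin (2 * Real.pi * x)| < 1 := by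
        rw [abs_mul]; nlinarith [abs_nonneg t, abs_nonneg (Real.sin (2 * Real.pi * x))]
      linarith [(abs_lt.1 h2).2]
    have h := EE_lift x _ (t * (1 - Real.cos (2 * Real.pi * x))) hu
    rw [← hf] at h
    have sc : (Real.cos (2 * Real.pi * x) : ℂ)^2 + (Real.sin (2 * Real.pi * x) : ℂ)^2 = 1 := by
      exact_mod_cast Real.cos_sq_add_sin_sq _
    rw [EE_cs x] at h ⊢
    have I2 := Complex.I_sq
    push_cast at h
    push_cast at sc ⊢
    linear_combination h + (EE ((f.1 x : ℝ) : S1) * t * Complex.sin (2 * Real.pi * x)) * I2 -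
       t * Complex.I * sc - t * Complex.cos (2 * Real.pi * x) * Complex.sin (2 * Real.pi * x) * I2

theorem mob_half : Mob (proj half) (-1) 0 0 1 := by
  intro x
  induction x using QuotientAddGroup.induction_on with
  | H x =>
    show EE ((x + 1/2 : ℝ) : S1) * (0 * EE (x : S1) + 1) = -1 * EE (x : S1) + 0
    have : ((x + 1/2 : ℝ) : S1) = (x : S1) + ((1/2 : ℝ) : S1) := by push_cast; rfl
    rw [this, EE_add, EE_coe (1/2)]
    have : 2 * Real.pi * (1/2) = Real.pi := by ring
    rw [this, Complex.exp_pi_mul_I]; ring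

/-- The commutator of a hyperbolic and a parabolic is parabolic. -/
theorem mob_cm {f g : DL} {t c b β : ℝ} (ht : |t| < 1) (hb : b = (1 - t) * c) (hβ : β = 2 * t * c)
    (hf : Mob (proj f) 1 t t 1)
    (hg : Mob (proj g) (1 + b * Complex.I) (-b * Complex.I) (b * Complex.I) (1 - b * Complex.I)) :
    Mob (proj (cm f g)) (1 + β * Complex.I) (-β * Complex.I) (β * Complex.I)
      (1 - β * Complex.I) := by
  have h := ((hf.mul hg).mul hf.inv).mul hg.inv
  have hk : (1 - (t:ℂ)^2) ≠ 0 := by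
    have : 1 - t^2 ≠ 0 := by
      have := (sq_lt_one_iff_abs_lt_one t).2 ht
      linarith
    exact_mod_cast this
  have I2 := Complex.I_sq
  unfold cm
  rw [map_mul, map_mul, map_mul, map_inv, map_inv]
  subst hb hβ
  refine h.scale _ hk ?_ ?_ ?_ ?_
  · push_cast; ring_nf
  · push_cast; ring_nf
  · push_cast; ring_nf
  · push_cast; ring_nf

theorem mob_final {f g : Equiv.Perm S1} {β γ : ℝ} (hγ : γ * (1 + 4 * β^2) = 2 * β)
    (hf : Mob f (1 + β * Complex.I) (-β * Complex.I) (β * Complex.I) (1 - β * Complex.I))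
    (hg : Mob g (1 + γ * Complex.I) (-γ * Complex.I) (γ * Complex.I) (1 - γ * Complex.I)) :
    f * (proj half * g * (proj half)⁻¹) * f =
      rot ((2 / Real.pi * Real.arctan (2 * β) : ℝ) : S1) := by
  have h := (hf.mul ((mob_half.mul hg).mul mob_half.inv)).mul hf
  have hp : 0 < 1 + 4 * β^2 := by positivity
  have hk : ((1 + 4 * β^2 : ℝ) : ℂ) ≠ 0 := by exact_mod_cast hp.ne'
  have I2 := Complex.I_sq
  have hγ' : (γ : ℂ) * (1 + 4 * β^2) = 2 * β := by exact_mod_cast hγ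
  have hγ2 : (γ : ℂ) = 2 * β / (1 + 4 * β^2) := by
    push_cast at hk
    rw [eq_div_iff hk]; exact hγ'
  have ha := arctan_exp (2 * β)
  have hk2 : (1 - 2 * β * Complex.I : ℂ) ≠ 0 := by
    intro h0
    have := congrArg Complex.re h0
    simp at this
  have h2 : Mob (f * (proj half * g * (proj half)⁻¹) * f) ((1 + 2 * β * Complex.I)^2) 0 0
      ((1 - 2 * β * Complex.I)^2) := by
    refine h.scale (-1 / ((1 + 4 * β^2 : ℝ) : ℂ)) (by
      exact div_ne_zero (by norm_num) hk) ?_ ?_ ?_ ?_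
    all_goals
      rw [hγ2]
      push_cast at hk ⊢
      field_simp
      ring_nf
      simp only [Complex.I_sq, show Complex.I ^ 3 = - Complex.I by simp [pow_succ],
        show Complex.I ^ 4 = 1 by simp]
      have hk3 : (1 + (β:ℂ)^2 * 4) ≠ 0 := by rw [mul_comm]; exact hk
      field_simp
      ring
  refine h2.rot (pow_ne_zero 2 hk2) _ ?_
  rw [EE_coe]
  have e1 : 2 * Real.pi * (2 / Real.pi * Real.arctan (2 * β)) =
    2 * (2 * Real.arctan (2 * β)) := by field_simp
  have e2 : Complex.exp ((2 * (2 * Real.arctan (2 * β)) : ℝ) * Complex.I) =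
      (Complex.exp ((2 * Real.arctan (2 * β) : ℝ) * Complex.I))^2 := by
    rw [← Complex.exp_nat_mul]; congr 1; push_cast; ring
  rw [e1, e2, ← mul_pow]
  congr 1
  rw [← Complex.ofReal_ofNat, ← Complex.ofReal_mul]
  exact ha

theorem nice_arctan (U V : ℝ × ℝ → ℝ) (hU : ContDiff ℝ (⊤ : ℕ∞) U) (hV : ContDiff ℝ (⊤ : ℕ∞) V)
    (hpos : ∀ p, 0 < U p) (h0 : ∀ x, V (0, x) = 0)
    (hUp : ∀ s x, U (s, x + 1) = U (s, x)) (hVp : ∀ s x, V (s, x + 1) = V (s, x)) :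
    Nice (fun p => Real.arctan (V p / U p) / Real.pi) where
  smooth := ((hV.div hU (fun p => (hpos p).ne')).arctan).div_const _
  zero x := by simp [h0]
  per s x := by simp [hUp, hVp]

theorem cos_per (x : ℝ) : Real.cos (2 * Real.pi * (x + 1)) = Real.cos (2 * Real.pi * x) := by
  rw [mul_add, mul_one, Real.cos_add_two_pi]
theorem sin_per (x : ℝ) : Real.sin (2 * Real.pi * (x + 1)) = Real.sin (2 * Real.pi * x) := by
  rw [mul_add, mul_one, Real.sin_add_two_pi]

theorem nice_H : Nice (fun p : ℝ × ℝ => Real.arctan ((- (Real.sin p.1 / 4) *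
    Real.sin (2 * Real.pi * p.2)) / (1 + (Real.sin p.1 / 4) * Real.cos (2 * Real.pi * p.2))) /
      Real.pi) := by
  refine nice_arctan (fun p => 1 + (Real.sin p.1 / 4) * Real.cos (2 * Real.pi * p.2))
    (fun p => - (Real.sin p.1 / 4) * Real.sin (2 * Real.pi * p.2)) (by fun_prop) (by fun_prop)
    ?_ (by simp) (by simp [cos_per]) (by simp [sin_per])
  intro p
  have h1 := abs_le.1 (Real.abs_cos_le_one (2 * Real.pi * p.2))
  have h2 := abs_le.1 (Real.abs_sin_le_one p.1)
  nlinarith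

theorem nice_P (b : ℝ → ℝ) (hb : ContDiff ℝ (⊤ : ℕ∞) b) (hb0 : b 0 = 0) (hb1 : ∀ s, |b s| < 1) :
    Nice (fun p : ℝ × ℝ => Real.arctan ((b p.1 * (1 - Real.cos (2 * Real.pi * p.2))) /
      (1 - b p.1 * Real.sin (2 * Real.pi * p.2))) / Real.pi) := by
  refine nice_arctan (fun p => 1 - b p.1 * Real.sin (2 * Real.pi * p.2))
    (fun p => b p.1 * (1 - Real.cos (2 * Real.pi * p.2))) (by fun_prop) (by fun_prop)
    ?_ (by simp [hb0]) (by simp [sin_per]) (by simp [cos_per])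
  intro p
  have h1 := Real.abs_sin_le_one (2 * Real.pi * p.2)
  have h2 : |b p.1 * Real.sin (2 * Real.pi * p.2)| < 1 := by
    rw [abs_mul]
    nlinarith [hb1 p.1, abs_nonneg (b p.1), abs_nonneg (Real.sin (2 * Real.pi * p.2))]
  linarith [(abs_lt.1 h2).2]

theorem short_rot : ∃ δ > 0, Short (fun s =>
    rot ((2 / Real.pi * Real.arctan (4 * (Real.sin (δ * Real.sin s) / 4)^2) : ℝ) : S1)) := by
  let T : ℝ → ℝ := fun s => Real.sin s / 4
  have hT : ∀ s, |T s| ≤ 1/4 := fun s => by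
    have := Real.abs_sin_le_one s
    simp only [T, abs_div]; norm_num; linarith
  let c₂ : ℝ → ℝ := fun s => 2 * T s / (1 + 16 * T s ^ 4)
  let b₁ : ℝ → ℝ := fun s => (1 - T s) * T s
  let b₂ : ℝ → ℝ := fun s => (1 - T s) * c₂ s
  have hTs : ContDiff ℝ (⊤ : ℕ∞) T := by simp only [T]; fun_prop
  have h1s : ContDiff ℝ (⊤ : ℕ∞) b₁ := by simp only [b₁]; fun_prop
  have hden : ∀ s, 1 + 16 * T s ^ 4 ≠ 0 := fun s => by positivity
  have hcs : ContDiff ℝ (⊤ : ℕ∞) c₂ := by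
    simp only [c₂]
    exact (contDiff_const.mul hTs).div (contDiff_const.add (contDiff_const.mul (hTs.pow 4))) hden
  have h2s : ContDiff ℝ (⊤ : ℕ∞) b₂ := by simp only [b₂]; fun_prop
  have hc : ∀ s, |c₂ s| ≤ 1/2 := fun s => by
    simp only [c₂, abs_div, abs_mul]
    have : (1:ℝ) ≤ 1 + 16 * T s ^ 4 := by have : 0 ≤ T s ^ 4 := by positivity
                                          linarith
    rw [abs_of_pos (by linarith : 0 < 1 + 16 * T s ^ 4), div_le_iff₀ (by linarith)]
    have := hT s
    norm_num
    linarith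
  have h1T : ∀ s, |1 - T s| ≤ 5/4 := fun s => by
    have := abs_le.1 (hT s)
    rw [abs_le]; constructor <;> linarith
  have hb1 : ∀ s, |b₁ s| < 1 := fun s => by
    simp only [b₁, abs_mul]; nlinarith [hT s, h1T s, abs_nonneg (T s), abs_nonneg (1 - T s)]
  have hb2 : ∀ s, |b₂ s| < 1 := fun s => by
    simp only [b₂, abs_mul]; nlinarith [hc s, h1T s, abs_nonneg (c₂ s), abs_nonneg (1 - T s)]
  obtain ⟨δ₁, hδ₁, H₁⟩ := frag nice_H (nice_P b₁ h1s (by simp [b₁, T]) hb1)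
  obtain ⟨δ₂, hδ₂, H₂⟩ := frag nice_H (nice_P b₂ h2s (by simp [b₂, T, c₂]) hb2)
  set δ := min δ₁ δ₂ / 2 with hδ
  have hm : 0 < min δ₁ δ₂ := lt_min hδ₁ hδ₂
  have hδ0 : 0 < δ := by positivity
  obtain ⟨f, g, hf, hg, S₁⟩ := H₁ δ hδ0 (by have := min_le_left δ₁ δ₂; linarith)
  obtain ⟨f', g', hf', hg', S₂⟩ := H₂ δ hδ0 (by have := min_le_right δ₁ δ₂; linarith)
  refine ⟨δ, hδ0, ?_⟩
  have S := (S₁.mul (S₂.conj (proj half) hasLift_half)).mul S₁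
  convert S using 2 with s
  have hT1 : |T (δ * Real.sin s)| < 1 := by linarith [hT (δ * Real.sin s)]
  have m1 := mob_cm (β := 2 * T (δ * Real.sin s) ^ 2) hT1 rfl (by ring)
    (mob_H (f s) _ hT1 (hf s)) (mob_P (g s) _ (hb1 (δ * Real.sin s)) (hg s))
  have m2 := mob_cm (c := c₂ (δ * Real.sin s)) hT1 rfl rfl
    (mob_H (f' s) _ hT1 (hf' s)) (mob_P (g' s) _ (hb2 (δ * Real.sin s)) (hg' s))
  have := mob_final (by
    simp only [c₂]
    have := hden (δ * Real.sin s)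
    have e : 1 + 4 * (2 * T (δ * Real.sin s) ^ 2) ^ 2 = 1 + 16 * T (δ * Real.sin s) ^ 4 := by ring
    rw [e]; field_simp) m1 m2
  rw [this]
  congr 3
  simp only [T]
  ring_nf

theorem rot_pow (t : S1) (n : ℕ) : (rot t) ^ n = rot (n • t) := by
  induction n with
  | zero => ext x; simp [rot]
  | succ n ih =>
    rw [pow_succ, ih]
    ext x
    show x + t + n • t = x + (n+1) • t
    rw [succ_nsmul]; abel

theorem rot_neg (t : S1) : rot (-t) = (rot t)⁻¹ := by
  rw [eq_inv_iff_mul_eq_one]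
  ext x
  show x + t + -t = x
  abel

theorem hasLift_rot (t : S1) : HasLift (rot t) := by
  induction t using QuotientAddGroup.induction_on with
  | H a =>
    refine ⟨fun x => x + a, by fun_prop, fun x => by ring, fun x => by simp, fun x => ?_⟩
    show (x : S1) + (a : S1) = ((x + a : ℝ) : S1)
    push_cast; rfl

theorem eps_surj (δ : ℝ) (hδ : 0 < δ) (τ : ℝ) (hτ : 0 < τ) : ∃ η > 0, ∀ e, 0 ≤ e → e ≤ η →
    ∃ s, |s| < τ ∧ 2 / Real.pi * Real.arctan (4 * (Real.sin (δ * Real.sin s) / 4)^2) = e := by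
  set s₀ := min (τ/2) (min 1 (1/δ)) with hs₀
  have p0 : 0 < s₀ := by positivity
  have p1 : s₀ ≤ τ / 2 := min_le_left _ _
  have p2 : s₀ ≤ 1 := (min_le_right _ _).trans (min_le_left _ _)
  have p3 : s₀ ≤ 1/δ := (min_le_right _ _).trans (min_le_right _ _)
  have q1 : 0 < Real.sin s₀ := Real.sin_pos_of_pos_of_lt_pi p0 (by linarith [Real.pi_gt_three])
  have q2 : δ * Real.sin s₀ ≤ 1 := by
    have : Real.sin s₀ ≤ 1/δ := (Real.sin_le p0.le).trans p3
    rw [le_div_iff₀ hδ] at this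
    linarith
  have q3 : 0 < Real.sin (δ * Real.sin s₀) :=
    Real.sin_pos_of_pos_of_lt_pi (by positivity) (by linarith [Real.pi_gt_three])
  let f : ℝ → ℝ := fun s => 2 / Real.pi * Real.arctan (4 * (Real.sin (δ * Real.sin s) / 4)^2)
  have hf : Continuous f := by
    simp only [f]
    fun_prop
  have f0 : f 0 = 0 := by simp [f]
  refine ⟨f s₀, ?_, ?_⟩
  · have : 0 < Real.arctan (4 * (Real.sin (δ * Real.sin s₀) / 4)^2) :=
      Real.arctan_pos.2 (by positivity)
    simp only [f]
    have := Real.pi_pos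
    positivity
  · intro e he1 he2
    obtain ⟨s, hs, hse⟩ := intermediate_value_Icc p0.le hf.continuousOn
      (show e ∈ Set.Icc (f 0) (f s₀) from ⟨by rw [f0]; exact he1, he2⟩)
    refine ⟨s, ?_, hse⟩
    rw [abs_of_nonneg hs.1]
    linarith [hs.2]

theorem dirichlet (a : ℝ) (L : ℕ) (hL : 0 < L) (η : ℝ) (hη : 0 < η) :
    ∃ m : ℕ, L ≤ m ∧ ∃ e : ℝ, |e| ≤ η ∧ m • (a : S1) = (e : S1) := by
  obtain ⟨N, hN⟩ := exists_nat_gt (L / η)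
  have hLp : (0:ℝ) < L := by exact_mod_cast hL
  have hN0 : 0 < N := by
    have : (0:ℝ) < N := lt_trans (by positivity) hN
    exact_mod_cast this
  obtain ⟨k, hk0, hkN, hk⟩ := Real.exists_nat_abs_mul_sub_round_le a hN0
  refine ⟨L * k, Nat.le_mul_of_pos_right L hk0, L * (k * a - round (k * a)), ?_, ?_⟩
  · rw [abs_mul, abs_of_pos hLp]
    calc (L:ℝ) * |k * a - round (k * a)| ≤ L * (1 / (N + 1)) := by gcongr
      _ ≤ η := by
        rw [mul_one_div, div_le_iff₀ (by positivity)]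
        rw [div_lt_iff₀ hη] at hN
        nlinarith
  · have : (L * (k * a - round (k * a)) : ℝ) = (L * k : ℕ) • a - ((L * round (k * a) : ℤ) : ℝ) := by
      simp only [nsmul_eq_mul]; push_cast; ring
    rw [this, AddCircle.coe_sub, AddCircle.coe_nsmul]
    have h0 : (((L * round (k * a) : ℤ) : ℝ) : S1) = 0 := by
      rw [AddCircle.coe_eq_zero_iff]
      exact ⟨L * round (k * a), by simp⟩
    rw [h0, sub_zero]

theorem WL.wordLength_le {S : Set (Equiv.Perm S1)} {g : Equiv.Perm S1} {k : ℕ} (h : WL S g k) :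
    wordLength S g ≤ k := by
  obtain ⟨l, h1, h2, h3⟩ := h
  have : wordLength S g ≤ l.length := Nat.sInf_le ⟨l, rfl, h2, h3⟩
  exact this.trans h1

theorem WL.wordLength {S : Set (Equiv.Perm S1)} {g : Equiv.Perm S1} {k : ℕ} (h : WL S g k) :
    WL S g (wordLength S g) := by
  obtain ⟨l, h1, h2, h3⟩ := h
  have : _root_.wordLength S g ∈ {k | ∃ l : List (Equiv.Perm S1),
    l.length = k ∧ (∀ x ∈ l, x ∈ S ∨ x⁻¹ ∈ S) ∧ l.prod = g} := Nat.sInf_mem ⟨_, l, rfl, h2, h3⟩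
  obtain ⟨l', h1', h2', h3'⟩ := this
  exact ⟨l', h1'.le, h2', h3'⟩

/-- every rotation of the circle is a distortion element of
Diff^∞(ℝ/ℤ). -/
theorem rotation_isDistortion (α : S1) : IsDistortion (rot α) := by
  classical
  obtain ⟨a, rfl⟩ : ∃ a : ℝ, (a : S1) = α := QuotientAddGroup.mk_surjective α
  obtain ⟨δ, hδ, K, τ, hτ, H⟩ := short_rot
  have key : ∀ n : ℕ, ∃ m : ℕ, (n + 1) * (K n + 1) ≤ m ∧ ∃ s : ℝ, |s| < τ n ∧
      (rot (a : S1) ^ m = rot ((2 / Real.pi *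
        Real.arctan (4 * (Real.sin (δ * Real.sin s) / 4)^2) : ℝ) : S1) ∨
       rot (a : S1) ^ m = (rot ((2 / Real.pi *
        Real.arctan (4 * (Real.sin (δ * Real.sin s) / 4)^2) : ℝ) : S1))⁻¹) := by
    intro n
    obtain ⟨η, hη, hs⟩ := eps_surj δ hδ (τ n) (hτ n)
    obtain ⟨m, hm, e, he, hme⟩ := dirichlet a ((n + 1) * (K n + 1)) (by positivity) η hη
    obtain ⟨s, hs1, hs2⟩ := hs |e| (abs_nonneg e) he
    refine ⟨m, hm, s, hs1, ?_⟩
    rw [hs2, rot_pow, hme]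
    rcases abs_choice e with h | h
    · left; rw [h]
    · right
      rw [h, ← rot_neg, ← AddCircle.coe_neg, neg_neg]
  choose m hm s hs hrot using key
  obtain ⟨S, hS, hW⟩ := H s hs
  refine ⟨insert (rot (a : S1)) S, ?_, Subgroup.subset_closure (by simp), ?_⟩
  · intro g hg
    rcases Finset.mem_insert.1 hg with rfl | hg
    · exact hasLift_rot _
    · exact hS g hg
  set S' : Set (Equiv.Perm S1) := ((insert (rot (a : S1)) S : Finset _) : Set (Equiv.Perm S1))
    with hS'
  have hW1 : ∀ n, WL S' (rot (a : S1) ^ n) (n * 1) := fun n =>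
    (WL.of_mem (by simp [hS'])).pow n
  have hWm : ∀ n, WL S' (rot (a : S1) ^ (m n)) (K n) := by
    intro n
    have h1 := (hW n).mono (show (S : Set (Equiv.Perm S1)) ⊆ S' by simp [hS']) le_rfl
    rcases hrot n with h | h
    · rw [h]; exact h1
    · rw [h]; exact h1.inv
  let d : ℕ → ℝ := fun n => (wordLength S' (rot (a : S1) ^ n) : ℝ)
  have hd : Subadditive d := by
    intro p q
    have : wordLength S' (rot (a : S1) ^ (p + q)) ≤ wordLength S' (rot (a : S1) ^ p) +
        wordLength S' (rot (a : S1) ^ q) := by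
      rw [pow_add]
      exact ((hW1 p).wordLength.mul (hW1 q).wordLength).wordLength_le
    simp only [d]
    exact_mod_cast this
  have hb : BddBelow (Set.range fun n => d n / n) := by
    refine ⟨0, ?_⟩
    rintro _ ⟨n, rfl⟩
    positivity
  have hl := hd.tendsto_lim hb
  have hmt : Tendsto m atTop atTop := by
    refine tendsto_atTop_mono (fun n => ?_) tendsto_id
    have := hm n
    show n ≤ m n
    nlinarith [Nat.zero_le (n * K n)]
  have h2 := hl.comp hmt
  have h3 : Tendsto (fun n => d (m n) / (m n : ℝ)) atTop (nhds 0) := by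
    refine squeeze_zero (fun n => by positivity) (fun n => ?_)
      tendsto_one_div_add_atTop_nhds_zero_nat
    have e1 : d (m n) ≤ K n := by
      simp only [d]; exact_mod_cast (hWm n).wordLength_le
    have e2 : ((n:ℝ) + 1) * (K n + 1) ≤ m n := by exact_mod_cast hm n
    have e3 : (0:ℝ) < m n := lt_of_lt_of_le (by positivity) e2
    rw [div_le_div_iff₀ e3 (by positivity)]
    nlinarith [(Nat.cast_nonneg n : (0:ℝ) ≤ n)]
  have h4 : hd.lim = 0 := tendsto_nhds_unique h2 h3
  rw [h4] at hl
  exact hl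

end
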